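/- Let X = {0} ∪ {1/k : k ∈ ℕ, k ≥ 1} with the metric inherited from ℝ, and fix n ≥ 2. Define r : X(n) → X(n−1) by r(A) = A \ {min A} if |A| = n, and r(A) = A if |A| < n. Then r is a retraction of X(n) onto X(n−1) that is Hölder continuous with exponent 1/2: Δ(r(A), r(B)) ≤ 4·Δ(A,B)^{1/2} for all A, B ∈ X(n). -/

import Mathlib

/-- `A` is a member of the finite subset space `Y(n)` of the subset `Y` of a metric
space: `A` is a nonempty subset of `Y` with at most `n` elements. -/
def MemFinSubsetSpace {X : Type*} (Y : Set X) (n : ℕ) (A : Set X) : Prop :=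
  A.Finite ∧ A.Nonempty ∧ A.ncard ≤ n ∧ A ⊆ Y

/-- The map deleting the least element from sets with exactly `n` elements:
`r(A) = A \ {min A}` if `|A| = n` and `r(A) = A` otherwise. -/
noncomputable def deleteMin (n : ℕ) (A : Set ℝ) : Set ℝ :=
  if A.ncard = n then A \ {sInf A} else A

/-- The set `X = {0} ∪ {1/k : k ∈ ℕ, k ≥ 1}`. -/
def seqSpace : Set ℝ := insert 0 {x : ℝ | ∃ k : ℕ, 1 ≤ k ∧ x = 1 / (k : ℝ)}

/-- Distinct points `x`, `y` of `seqSpace` are at distance at least `x ^ 2 / 2`. -/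
lemma seqSpace_sq_le_dist {x y : ℝ} (hx : x ∈ seqSpace) (hy : y ∈ seqSpace) (hne : x ≠ y) :
    x ^ 2 / 2 ≤ dist x y := by
  rw [Real.dist_eq]
  rcases hx with rfl | ⟨k, hk, rfl⟩
  · simp
  have hk' : (1 : ℝ) ≤ k := by exact_mod_cast hk
  have hk0 : (0 : ℝ) < k := by linarith
  rcases hy with rfl | ⟨l, hl, rfl⟩
  · rw [sub_zero, abs_of_nonneg (by positivity), div_pow, one_pow, div_div,
      div_le_div_iff₀ (by positivity) hk0]
    nlinarith
  have hl' : (1 : ℝ) ≤ l := by exact_mod_cast hl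
  have hl0 : (0 : ℝ) < l := by linarith
  rcases lt_trichotomy k l with h | rfl | h
  · have h' : (k : ℝ) + 1 ≤ l := by exact_mod_cast h
    refine le_trans ?_ (le_abs_self _)
    have hle : 1 / (l : ℝ) ≤ 1 / (k + 1) := one_div_le_one_div_of_le (by linarith) h'
    have hgap : (1 / (k : ℝ)) ^ 2 / 2 ≤ 1 / k - 1 / (k + 1) := by
      rw [div_sub_div _ _ hk0.ne' (by linarith), div_pow, one_pow, div_div,
        div_le_div_iff₀ (by positivity) (by positivity)]
      nlinarith
    linarith
  · exact absurd rfl hne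
  · have h' : (l : ℝ) + 1 ≤ k := by exact_mod_cast h
    refine le_trans ?_ (neg_le_abs _)
    rw [neg_sub, div_sub_div _ _ hl0.ne' hk0.ne', div_pow, one_pow, div_div,
      div_le_div_iff₀ (by positivity) (by positivity)]
    nlinarith [mul_pos hk0 hl0, mul_nonneg hk0.le (sub_nonneg.2 h')]

lemma seqSpace_subset_Icc : seqSpace ⊆ Set.Icc 0 1 := by
  rintro x (rfl | ⟨k, hk, rfl⟩)
  · simp
  · have hk' : (1 : ℝ) ≤ k := by exact_mod_cast hk
    exact ⟨by positivity, div_le_one_of_le₀ hk' (by positivity)⟩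

lemma seqSpace_eq_of_dist_le {d x y : ℝ} (hx : x ∈ seqSpace) (hy : y ∈ seqSpace)
    (hd : 0 ≤ d) (hxy : dist x y ≤ d) (hdx : 2 * √d ≤ x) : x = y := by
  by_contra hne
  have hgap := seqSpace_sq_le_dist hx hy hne
  have hpos := dist_pos.2 hne
  nlinarith [Real.sq_sqrt hd, Real.sqrt_nonneg d]

lemma Set.Finite.exists_dist_le_hausdorffDist {X : Type*} [MetricSpace X] {A B : Set X}
    (hA : A.Finite) (hB : B.Finite) (hBne : B.Nonempty) {a : X} (ha : a ∈ A) :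
    ∃ b ∈ B, dist a b ≤ Metric.hausdorffDist A B := by
  obtain ⟨b, hb, hab⟩ := hB.isCompact.exists_infDist_eq_dist hBne a
  exact ⟨b, hb, hab ▸ Metric.infDist_le_hausdorffDist_of_mem ha
    (Metric.hausdorffEDist_ne_top_of_nonempty_of_bounded ⟨a, ha⟩ hBne hA.isBounded hB.isBounded)⟩

lemma deleteMin_subset (n : ℕ) (A : Set ℝ) : deleteMin n A ⊆ A := by
  unfold deleteMin
  split_ifs
  exacts [Set.sdiff_subset, subset_rfl]

lemma MemFinSubsetSpace.deleteMin {Y : Set ℝ} {n : ℕ} (hn : 2 ≤ n) {A : Set ℝ}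
    (hA : MemFinSubsetSpace Y n A) : MemFinSubsetSpace Y (n - 1) (deleteMin n A) := by
  obtain ⟨hfin, hne, hcard, hsub⟩ := hA
  refine ⟨hfin.subset (deleteMin_subset n A), ?_, ?_, (deleteMin_subset n A).trans hsub⟩
  all_goals
    unfold _root_.deleteMin
    split_ifs with h
  · rw [← Set.ncard_pos (hfin.subset Set.sdiff_subset),
      Set.ncard_sdiff_singleton_of_mem (hne.csInf_mem hfin)]
    omega
  · exact hne
  · rw [Set.ncard_sdiff_singleton_of_mem (hne.csInf_mem hfin), h]
  · omega

/-- If two sets of at most `n` nonnegative reals agree on `[t, ∞)` and `A` lies within `t` of `B`,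
then `deleteMin n A` lies within `t` of `deleteMin n B`. -/
lemma exists_mem_deleteMin_dist_le {n : ℕ} {A B : Set ℝ} {t : ℝ} (hA : A.Finite) (hB : B.Finite)
    (hBne : B.Nonempty) (hAn : A.ncard ≤ n) (hA0 : ∀ a ∈ A, 0 ≤ a) (hB0 : ∀ b ∈ B, 0 ≤ b)
    (ht : 0 ≤ t) (hagree : ∀ x, t ≤ x → (x ∈ A ↔ x ∈ B))
    (hnear : ∀ a ∈ A, ∃ b ∈ B, dist a b ≤ t) {a : ℝ} (ha : a ∈ deleteMin n A) :
    ∃ b ∈ deleteMin n B, dist a b ≤ t := by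
  have haA := deleteMin_subset n A ha
  by_cases hBn : B.ncard = n
  swap
  · simpa [deleteMin, hBn] using hnear a haA
  have hrB : deleteMin n B = B \ {sInf B} := if_pos hBn
  rcases le_or_gt t a with hat | hat
  · by_cases hmin : a = sInf B
    · have hBA : B ⊆ A := fun b hb =>
        (hagree b (hat.trans (hmin ▸ csInf_le hB.bddBelow hb))).2 hb
      have hEq : B = A := Set.eq_of_subset_of_ncard_le hBA (hAn.trans hBn.ge) hA
      exact ⟨a, hEq ▸ ha, by simpa using ht⟩
    · exact ⟨a, hrB ▸ ⟨(hagree a hat).1 haA, hmin⟩, by simpa using ht⟩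
  · by_contra! hfar
    have hge : ∀ b ∈ B \ {sInf B}, t ≤ b := by
      intro b hb
      by_contra! hbt
      have hlt := hfar b (hrB ▸ hb)
      have := abs_sub_le_of_nonneg_of_le (hA0 a haA) hat.le (hB0 b hb.1) hbt.le
      rw [Real.dist_eq] at hlt
      linarith
    have hsub : insert a (B \ {sInf B}) ⊆ A := by
      rintro x (rfl | hx)
      · exact haA
      · exact (hagree x (hge x hx)).2 hx.1
    have hnot : a ∉ B \ {sInf B} := fun h => hat.not_ge (hge a h)
    have hcard : (insert a (B \ {sInf B})).ncard = n := by
      rw [Set.ncard_insert_of_notMem hnot (hB.subset Set.sdiff_subset),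
        Set.ncard_sdiff_singleton_add_one (hBne.csInf_mem hB) hB, hBn]
    have hEq := Set.eq_of_subset_of_ncard_le hsub (hAn.trans hcard.ge) hA
    have hrA : deleteMin n A = A \ {sInf A} := if_pos (hEq ▸ hcard)
    have hmin : IsLeast A a := by
      refine ⟨haA, fun x hx => ?_⟩
      rw [← hEq] at hx
      rcases hx with rfl | hx
      · exact le_rfl
      · exact hat.le.trans (hge x hx)
    rw [hrA] at ha
    exact ha.2 hmin.csInf_eq.symm

lemma exists_mem_deleteMin_dist_le_sqrt {n : ℕ} {A B : Set ℝ}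
    (hA : MemFinSubsetSpace seqSpace n A) (hB : MemFinSubsetSpace seqSpace n B)
    {a : ℝ} (ha : a ∈ deleteMin n A) :
    ∃ b ∈ deleteMin n B, dist a b ≤ 2 * √(Metric.hausdorffDist A B) := by
  obtain ⟨hAf, hAne, hAn, hAX⟩ := hA
  obtain ⟨hBf, hBne, -, hBX⟩ := hB
  have hd : 0 ≤ Metric.hausdorffDist A B := Metric.hausdorffDist_nonneg
  have hAB : ∀ a ∈ A, ∃ b ∈ B, dist a b ≤ Metric.hausdorffDist A B := fun a ha =>
    hAf.exists_dist_le_hausdorffDist hBf hBne ha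
  have hBA : ∀ b ∈ B, ∃ a ∈ A, dist b a ≤ Metric.hausdorffDist A B := fun b hb =>
    Metric.hausdorffDist_comm (s := A) (t := B) ▸ hBf.exists_dist_le_hausdorffDist hAf hAne hb
  refine exists_mem_deleteMin_dist_le hAf hBf hBne hAn
    (fun a ha => (seqSpace_subset_Icc (hAX ha)).1) (fun b hb => (seqSpace_subset_Icc (hBX hb)).1)
    (by positivity) (fun x hx => ⟨fun hxA => ?_, fun hxB => ?_⟩) (fun a ha => ?_) ha
  · obtain ⟨b, hb, hxb⟩ := hAB x hxA
    exact seqSpace_eq_of_dist_le (hAX hxA) (hBX hb) hd hxb hx ▸ hb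
  · obtain ⟨a, ha, hxa⟩ := hBA x hxB
    exact seqSpace_eq_of_dist_le (hBX hxB) (hAX ha) hd hxa hx ▸ ha
  · obtain ⟨b, hb, hab⟩ := hAB a ha
    rcases le_or_gt (2 * √(Metric.hausdorffDist A B)) a with h | h
    · exact ⟨b, hb, by simp [seqSpace_eq_of_dist_le (hAX ha) (hBX hb) hd hab h]⟩
    · refine ⟨b, hb, ?_⟩
      rcases le_or_gt (2 * √(Metric.hausdorffDist A B)) b with h' | h'
      · have hba := seqSpace_eq_of_dist_le (hBX hb) (hAX ha) hd (dist_comm a b ▸ hab) h'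
        simp [hba]
      · exact abs_sub_le_of_nonneg_of_le (seqSpace_subset_Icc (hAX ha)).1 h.le
          (seqSpace_subset_Icc (hBX hb)).1 h'.le

/-- Proposition 4.6(a): on `X = {0} ∪ {1/k}`, the delete-the-minimum map is a retraction
of `X(n)` onto `X(n-1)` that is Hölder continuous with exponent `1/2`:
`Δ(r(A), r(B)) ≤ 4 √(Δ(A,B))`. -/
theorem deleteMin_holder_retraction (n : ℕ) (hn : 2 ≤ n) :
    (∀ A : Set ℝ, MemFinSubsetSpace seqSpace n A →
      MemFinSubsetSpace seqSpace (n - 1) (deleteMin n A)) ∧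
    (∀ A : Set ℝ, MemFinSubsetSpace seqSpace (n - 1) A → deleteMin n A = A) ∧
    (∀ A B : Set ℝ, MemFinSubsetSpace seqSpace n A → MemFinSubsetSpace seqSpace n B →
      Metric.hausdorffDist (deleteMin n A) (deleteMin n B) ≤
        4 * Real.sqrt (Metric.hausdorffDist A B)) := by
  refine ⟨fun A hA => hA.deleteMin hn, fun A hA => ?_, fun A B hA hB => ?_⟩
  · have := hA.2.2.1
    exact if_neg (by omega)
  · have hs := Real.sqrt_nonneg (Metric.hausdorffDist A B)
    refine (Metric.hausdorffDist_le_of_mem_dist (r := 2 * √(Metric.hausdorffDist A B))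
      (by positivity) (fun a ha => exists_mem_deleteMin_dist_le_sqrt hA hB ha)
      (fun b hb => ?_)).trans (by linarith)
    rw [Metric.hausdorffDist_comm]
    exact exists_mem_deleteMin_dist_le_sqrt hB hA hb
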